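/- arXiv:2307.04314 — 2 statements merged into one kernel-verified Lean document; each statement's English description precedes it below -/
import Mathlib

section
/- For every d with 0 ≤ d ≤ 2, the μ-measure of the set of directed lines whose two intersection points X and Y with S² satisfy ‖X − Y‖ ≤ d equals d²/4. -/
open MeasureTheory Metric Real Filter
open scoped ENNReal RealInnerProductSpace Topology

noncomputable section

/-- Euclidean space `ℝⁿ`. -/
abbrev En (n : ℕ) := EuclideanSpace ℝ (Fin n)

/-- The unit sphere `S^{n-1} ⊂ ℝⁿ`. -/
def unitSphere (n : ℕ) : Set (En n) := Metric.sphere 0 1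

/-- The uniform probability (normalized surface) measure on the unit sphere. -/
def sigmaN (n : ℕ) : Measure (En n) :=
  (μH[(n : ℝ) - 1] (unitSphere n))⁻¹ •
    (μH[(n : ℝ) - 1] : Measure (En n)).restrict (unitSphere n)

/-- The open unit disc in the hyperplane orthogonal to `v`. -/
def disc (n : ℕ) (v : En n) : Set (En n) := {z | ⟪v, z⟫ = 0 ∧ ‖z‖ < 1}

/-- Normalized `(n-1)`-dimensional Hausdorff measure on the disc `{z ∈ v⊥ : ‖z‖ < 1}`. -/
def lambdaN (n : ℕ) (v : En n) : Measure (En n) :=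
  (μH[(n : ℝ) - 1] (disc n v))⁻¹ •
    (μH[(n : ℝ) - 1] : Measure (En n)).restrict (disc n v)

/-- The normalized kinematic measure on directed lines meeting the unit sphere,
parametrized by pairs `(v, z)` with `v` the direction and `z ∈ v⊥`, `‖z‖ < 1`. -/
def kinematic (n : ℕ) : Measure (En n × En n) :=
  (sigmaN n).bind (fun v => (Measure.dirac v).prod (lambdaN n v))

/-- The entry point of the line parametrized by `(v, z)` in the unit sphere. -/
def Xpt (n : ℕ) (p : En n × En n) : En n := p.2 - Real.sqrt (1 - ‖p.2‖ ^ 2) • p.1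

/-- The exit point of the line parametrized by `(v, z)` in the unit sphere. -/
def Ypt (n : ℕ) (p : En n × En n) : En n := p.2 + Real.sqrt (1 - ‖p.2‖ ^ 2) • p.1



lemma exp_eq : (((3 : ℕ) : ℝ) - 1) = 2 := by norm_num

lemma hausdorff_sphere_lt_top : (μH[2] : Measure (En 3)) (unitSphere 3) < ∞ := by
  let f : ℝ × ℝ → En 3 := fun p =>
    WithLp.toLp 2 ![Real.sin p.1 * Real.cos p.2, Real.sin p.1 * Real.sin p.2, Real.cos p.1]
  have hf : ContDiff ℝ 1 f := by
    rw [contDiff_euclidean]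
    intro i
    fin_cases i
    · exact (Real.contDiff_sin.comp contDiff_fst).mul (Real.contDiff_cos.comp contDiff_snd)
    · exact (Real.contDiff_sin.comp contDiff_fst).mul (Real.contDiff_sin.comp contDiff_snd)
    · exact Real.contDiff_cos.comp contDiff_fst
  let K : Set (ℝ × ℝ) := Set.Icc 0 π ×ˢ Set.Icc (-π) π
  have hK : IsCompact K := isCompact_Icc.prod isCompact_Icc
  obtain ⟨C, hC⟩ := LocallyLipschitzOn.exists_lipschitzOnWith_of_compact hK
    hf.locallyLipschitz.locallyLipschitzOn
  have hsub : unitSphere 3 ⊆ f '' K := by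
    intro x hx
    have hx1 : ‖x‖ = 1 := by simpa [unitSphere] using hx
    have hx2 : x 0 ^ 2 + x 1 ^ 2 + x 2 ^ 2 = 1 := by
      have := EuclideanSpace.real_norm_sq_eq x
      rw [hx1, Fin.sum_univ_three] at this
      linarith
    set w : ℂ := ⟨x 0, x 1⟩ with hw
    have hwn : ‖w‖ = √(1 - x 2 ^ 2) := by
      rw [Complex.norm_def, Complex.normSq_mk]
      congr 1
      linarith
    refine ⟨(Real.arccos (x 2), Complex.arg w), ⟨⟨Real.arccos_nonneg _, Real.arccos_le_pi _⟩,
      ⟨(Complex.neg_pi_lt_arg w).le, Complex.arg_le_pi w⟩⟩, ?_⟩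
    ext i
    fin_cases i
    · simp only [f, Real.sin_arccos, ← hwn]
      exact Complex.norm_mul_cos_arg w
    · simp only [f, Real.sin_arccos, ← hwn]
      exact Complex.norm_mul_sin_arg w
    · exact Real.cos_arccos (by nlinarith [sq_nonneg (x 0), sq_nonneg (x 1)])
        (by nlinarith [sq_nonneg (x 0), sq_nonneg (x 1)])
  calc _ ≤ _ := measure_mono hsub
    _ ≤ _ := hC.hausdorffMeasure_image_le (by norm_num)
    _ < ∞ := by
      rw [hausdorffMeasure_prod_real]
      exact ENNReal.mul_lt_top (ENNReal.rpow_lt_top_of_nonneg (by norm_num) (by simp))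
        hK.measure_lt_top

lemma hausdorff_sphere_ne_zero : (μH[2] : Measure (En 3)) (unitSphere 3) ≠ 0 := by
  let g : En 3 → ℝ × ℝ := fun x => (x 0, x 1)
  have hc (i : Fin 3) : LipschitzWith 1 (fun x : En 3 => x i) :=
    LipschitzWith.of_dist_le_mul (fun x y => by
      simpa [dist_eq_norm] using PiLp.norm_apply_le (x - y) i)
  have hg : LipschitzWith 1 g := by simpa using (hc 0).prodMk (hc 1)
  intro h0
  have h1 := hg.hausdorffMeasure_image_le (d := 2) (by norm_num) (unitSphere 3)
  rw [h0, mul_zero, hausdorffMeasure_prod_real] at h1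
  have hsub : Metric.ball (0 : ℝ × ℝ) (1/2) ⊆ g '' unitSphere 3 := by
    rintro ⟨a, b⟩ hab
    have hab' : |a| < 1/2 ∧ |b| < 1/2 := by
      simpa [Prod.norm_def] using hab
    obtain ⟨ha, hb⟩ := hab'
    rw [abs_lt] at ha hb
    refine ⟨WithLp.toLp 2 ![a, b, √(1 - a^2 - b^2)], ?_, rfl⟩
    simp only [unitSphere, mem_sphere_zero_iff_norm]
    rw [← sq_eq_sq₀ (norm_nonneg _) zero_le_one, EuclideanSpace.real_norm_sq_eq,
      Fin.sum_univ_three]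
    simp only [Matrix.cons_val]
    rw [Real.sq_sqrt (by nlinarith)]
    ring
  have := (measure_mono hsub).trans h1
  exact absurd this (not_le.mpr (Metric.measure_ball_pos _ _ (by norm_num)))

instance : IsProbabilityMeasure (sigmaN 3) := by
  constructor
  rw [sigmaN, exp_eq]
  simp only [Measure.smul_apply, smul_eq_mul, Measure.restrict_apply_univ]
  exact ENNReal.inv_mul_cancel hausdorff_sphere_ne_zero hausdorff_sphere_lt_top.ne

lemma ae_sigma : ∀ᵐ v ∂(sigmaN 3), ‖v‖ = 1 := by
  have h : ∀ᵐ v ∂((μH[2] : Measure (En 3)).restrict (unitSphere 3)), ‖v‖ = 1 := by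
    filter_upwards [ae_restrict_mem (Metric.isClosed_sphere.measurableSet :
      MeasurableSet (unitSphere 3))] with v hv
    simpa [unitSphere] using hv
  rw [sigmaN, exp_eq]
  exact Measure.ae_smul_measure h _

/-- Scaling: the disc of radius `r` in `v⊥`. -/
lemma hausdorff_disc (v : En 3) (hv : ‖v‖ = 1) :
    (μH[2] : Measure (En 3)) (disc 3 v) ≠ 0 ∧ (μH[2] : Measure (En 3)) (disc 3 v) ≠ ∞ ∧
    ∀ r : ℝ, 0 ≤ r → (μH[2] : Measure (En 3)) {z | ⟪v, z⟫ = 0 ∧ ‖z‖ < r} =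
      ENNReal.ofReal (r ^ 2) * (μH[2] : Measure (En 3)) (disc 3 v) := by
  have hv0 : v ≠ 0 := by rintro rfl; simp at hv
  let F := (ℝ ∙ v)ᗮ
  have : Fact (Module.finrank ℝ (En 3) = 2 + 1) := ⟨by simp⟩
  have hF : Module.finrank ℝ F = 2 := Submodule.finrank_orthogonal_span_singleton hv0
  have : Nontrivial F := Module.nontrivial_of_finrank_pos (R := ℝ) (by omega)
  have key (r : ℝ) : (μH[2] : Measure (En 3)) {z | ⟪v, z⟫ = 0 ∧ ‖z‖ < r} =
      (μH[Module.finrank ℝ F] : Measure F) (Metric.ball 0 r) := by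
    rw [← (isometry_subtype_coe (s := (F : Set (En 3)))).hausdorffMeasure_image
      (Or.inl (by positivity)), hF]
    congr 1
    ext z
    simp only [Set.mem_setOf_eq, Set.mem_image, mem_ball_zero_iff]
    constructor
    · rintro ⟨h1, h2⟩
      exact ⟨⟨z, Submodule.mem_orthogonal_singleton_iff_inner_right.mpr h1⟩, h2, rfl⟩
    · rintro ⟨y, hy, rfl⟩
      exact ⟨Submodule.mem_orthogonal_singleton_iff_inner_right.mp y.2, hy⟩
  have hd : (μH[2] : Measure (En 3)) (disc 3 v) =
      (μH[Module.finrank ℝ F] : Measure F) (Metric.ball 0 1) := key 1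
  refine ⟨?_, ?_, ?_⟩
  · rw [hd]; exact (Metric.measure_ball_pos _ _ one_pos).ne'
  · rw [hd]; exact measure_ball_lt_top.ne
  · intro r hr
    rw [hd, key, Measure.addHaar_ball _ _ hr, hF]

lemma measurableSet_disc (v : En 3) (r : ℝ) :
    MeasurableSet {z : En 3 | ⟪v, z⟫ = 0 ∧ ‖z‖ < r} := by
  apply MeasurableSet.inter
  · exact (isClosed_eq (by fun_prop) continuous_const).measurableSet
  · exact (isOpen_lt continuous_norm continuous_const).measurableSet

lemma lambda_finite (v : En 3) (hv : ‖v‖ = 1) : IsFiniteMeasure (lambdaN 3 v) := by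
  constructor
  rw [lambdaN, exp_eq]
  simp only [Measure.smul_apply, smul_eq_mul, Measure.restrict_apply_univ]
  obtain ⟨h0, h1, -⟩ := hausdorff_disc v hv
  rw [ENNReal.inv_mul_cancel h0 h1]
  simp

lemma lambda_apply (v : En 3) (hv : ‖v‖ = 1) (d : ℝ) (hd0 : 0 ≤ d) (hd2 : d ≤ 2) :
    lambdaN 3 v {z | 2 * √(1 - ‖z‖ ^ 2) ≤ d} = ENNReal.ofReal (d ^ 2 / 4) := by
  obtain ⟨h0, h1, h2⟩ := hausdorff_disc v hv
  have hr2 : 0 ≤ 1 - d ^ 2 / 4 := by nlinarith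
  set r := √(1 - d ^ 2 / 4) with hr
  have hr0 : 0 ≤ r := Real.sqrt_nonneg _
  have hrs : r ^ 2 = 1 - d ^ 2 / 4 := Real.sq_sqrt hr2
  have hr1 : r ≤ 1 := by nlinarith [sq_nonneg d]
  have hm : MeasurableSet {z : En 3 | 2 * √(1 - ‖z‖ ^ 2) ≤ d} :=
    (isClosed_le (by fun_prop) continuous_const).measurableSet
  rw [lambdaN, exp_eq, Measure.smul_apply, smul_eq_mul, Measure.restrict_apply hm]
  have hset : {z : En 3 | 2 * √(1 - ‖z‖ ^ 2) ≤ d} ∩ disc 3 v =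
      disc 3 v \ {z | ⟪v, z⟫ = 0 ∧ ‖z‖ < r} := by
    ext z
    simp only [disc, Set.mem_inter_iff, Set.mem_setOf_eq, Set.mem_diff, not_and, not_lt]
    have hz0 := norm_nonneg z
    constructor
    · rintro ⟨h, hz, hz1⟩
      refine ⟨⟨hz, hz1⟩, fun _ => ?_⟩
      have := (Real.sqrt_le_left (by positivity : 0 ≤ d / 2)).mp
        (by linarith : √(1 - ‖z‖ ^ 2) ≤ d / 2)
      nlinarith
    · rintro ⟨⟨hz, hz1⟩, h⟩
      refine ⟨?_, hz, hz1⟩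
      have := h hz
      have : √(1 - ‖z‖ ^ 2) ≤ d / 2 := (Real.sqrt_le_left (by positivity)).mpr (by nlinarith)
      linarith
  have hsub : {z : En 3 | ⟪v, z⟫ = 0 ∧ ‖z‖ < r} ⊆ disc 3 v :=
    fun z hz => ⟨hz.1, hz.2.trans_le hr1⟩
  rw [hset, measure_diff hsub (measurableSet_disc v r).nullMeasurableSet
    ((measure_mono hsub).trans_lt h1.lt_top).ne, h2 r hr0]
  have : (μH[2] : Measure (En 3)) (disc 3 v) - ENNReal.ofReal (r ^ 2) * μH[2] (disc 3 v) =
      ENNReal.ofReal (d ^ 2 / 4) * μH[2] (disc 3 v) := by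
    have e : ENNReal.ofReal (d ^ 2 / 4) = 1 - ENNReal.ofReal (r ^ 2) := by
      rw [← ENNReal.ofReal_one, ← ENNReal.ofReal_sub _ (sq_nonneg r), hrs]
      congr 1
      ring
    rw [e, ENNReal.sub_mul (fun _ _ => h1), one_mul]
  rw [this, mul_comm, mul_assoc, ENNReal.mul_inv_cancel h0 h1, mul_one]

/-- A fixed unit vector. -/
def e0 : En 3 := EuclideanSpace.single 0 1

lemma norm_e0 : ‖e0‖ = 1 := by simp [e0]

/-- The reflection exchanging `e0` and `v`. -/
def refl0 (v : En 3) : En 3 ≃ₗᵢ[ℝ] En 3 := (ℝ ∙ (e0 - v))ᗮ.reflection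

lemma refl0_e0 (v : En 3) (hv : ‖v‖ = 1) : refl0 v e0 = v :=
  Submodule.reflection_sub (by rw [norm_e0, hv])

lemma measurable_refl0 : Measurable (fun p : En 3 × En 3 => refl0 p.1 p.2) := by
  have : (fun p : En 3 × En 3 => refl0 p.1 p.2) = fun p =>
      -((2 : ℝ) • (⟪e0 - p.1, p.2⟫ / ‖e0 - p.1‖ ^ 2) • (e0 - p.1) - p.2) := by
    ext1 p
    rw [refl0, Submodule.reflection_orthogonal_apply, Submodule.reflection_singleton_apply]
    simp [two_smul]
  rw [this]
  fun_prop

lemma lambda_eq_map (v : En 3) (hv : ‖v‖ = 1) :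
    lambdaN 3 v = (lambdaN 3 e0).map (refl0 v) := by
  have hpre : refl0 v ⁻¹' disc 3 v = disc 3 e0 := by
    ext z
    simp only [disc, Set.mem_preimage, Set.mem_setOf_eq, LinearIsometryEquiv.norm_map]
    nth_rewrite 1 [← refl0_e0 v hv]
    rw [LinearIsometryEquiv.inner_map_map]
  have hme : Measurable (refl0 v) := (refl0 v).continuous.measurable
  have hmu (s : Set (En 3)) : (μH[2] : Measure (En 3)) (refl0 v ⁻¹' s) = μH[2] s :=
    (refl0 v).toIsometryEquiv.hausdorffMeasure_preimage 2 s
  ext s hs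
  rw [Measure.map_apply hme hs, lambdaN, lambdaN, exp_eq]
  simp only [Measure.smul_apply, smul_eq_mul]
  rw [Measure.restrict_apply hs, Measure.restrict_apply (hme hs), ← hpre,
    ← Set.preimage_inter, hmu, hmu]

lemma aemeasurable_kernel :
    AEMeasurable (fun v => (Measure.dirac v).prod (lambdaN 3 v)) (sigmaN 3) := by
  have := lambda_finite e0 norm_e0
  have hm : Measurable (fun p : En 3 × En 3 => (p.1, refl0 p.1 p.2)) :=
    measurable_fst.prodMk measurable_refl0
  refine ⟨fun v => (lambdaN 3 e0).map (fun z => (v, refl0 v z)), ?_, ?_⟩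
  · refine Measure.measurable_of_measurable_coe _ fun s hs => ?_
    have : (fun v => (lambdaN 3 e0).map (fun z => (v, refl0 v z)) s) = fun v =>
        lambdaN 3 e0 (Prod.mk v ⁻¹' ((fun p : En 3 × En 3 => (p.1, refl0 p.1 p.2)) ⁻¹' s)) := by
      ext v
      exact Measure.map_apply (hm.comp (measurable_prodMk_left (x := v))) hs
    rw [this]
    exact measurable_measure_prodMk_left (hm hs)
  · filter_upwards [ae_sigma] with v hv
    have := lambda_finite v hv
    rw [Measure.dirac_prod, lambda_eq_map v hv, Measure.map_map measurable_prodMk_left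
      (refl0 v).continuous.measurable]
    rfl

/-- The probability that the two intersection points of a random line with `S²` are at
distance at most `d` equals `d²/4`. -/
theorem prob_dist_le (d : ℝ) (hd0 : 0 ≤ d) (hd2 : d ≤ 2) :
    kinematic 3 {p : En 3 × En 3 | ‖Xpt 3 p - Ypt 3 p‖ ≤ d} =
      ENNReal.ofReal (d ^ 2 / 4) := by
  have hms : MeasurableSet {p : En 3 × En 3 | ‖Xpt 3 p - Ypt 3 p‖ ≤ d} := by
    unfold Xpt Ypt
    exact (isClosed_le (by fun_prop) continuous_const).measurableSet
  rw [kinematic, Measure.bind_apply hms aemeasurable_kernel]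
  have : ∀ᵐ v ∂(sigmaN 3), ((Measure.dirac v).prod (lambdaN 3 v))
      {p : En 3 × En 3 | ‖Xpt 3 p - Ypt 3 p‖ ≤ d} = ENNReal.ofReal (d ^ 2 / 4) := by
    filter_upwards [ae_sigma] with v hv
    have := lambda_finite v hv
    rw [Measure.dirac_prod, Measure.map_apply measurable_prodMk_left hms,
      ← lambda_apply v hv d hd0 hd2]
    congr 1
    ext z
    have e : Xpt 3 (v, z) - Ypt 3 (v, z) = -((2 * √(1 - ‖z‖ ^ 2)) • v) := by
      simp only [Xpt, Ypt]
      module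
    simp only [Set.mem_preimage, Set.mem_setOf_eq]
    rw [e, norm_neg, norm_smul, hv, mul_one, Real.norm_of_nonneg (by positivity)]
  rw [lintegral_congr_ae this]
  simp


end
end

section
/- There exist constants c, C > 0 such that for every n ≥ 2, the expected distance between the entry and exit points of a random line meeting S^{n−1} satisfies c·n^{−1/2} ≤ ∫ ‖X(v,z) − Y(v,z)‖ dμ(v,z) ≤ C·n^{−1/2}, where μ is the normalized kinematic measure on directed lines meeting S^{n−1} ⊂ ℝⁿ. In particular, in high dimensions the entry and exit points are typically very close. -/
open MeasureTheory Metric Real Filter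
open scoped ENNReal RealInnerProductSpace Topology

noncomputable section

/-- The hyperplane orthogonal to `v`. -/
abbrev Wv (n : ℕ) (v : En n) : Submodule ℝ (En n) := (ℝ ∙ v)ᗮ

lemma finrank_Wv (n : ℕ) (hn : 2 ≤ n) (v : En n) (hv : ‖v‖ = 1) :
    Module.finrank ℝ (Wv n v) = n - 1 := by
  have : Fact (Module.finrank ℝ (En n) = (n - 1) + 1) := ⟨by simp; omega⟩
  exact Submodule.finrank_orthogonal_span_singleton (by rintro rfl; simp at hv)

lemma haar_Wv (n : ℕ) (hn : 2 ≤ n) (v : En n) (hv : ‖v‖ = 1) :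
    (μH[(n : ℝ) - 1] : Measure (Wv n v)).IsAddHaarMeasure := by
  have h : (n : ℝ) - 1 = (Module.finrank ℝ (Wv n v) : ℝ) := by
    rw [finrank_Wv n hn v hv, Nat.cast_sub (by omega)]; simp
  rw [h]; infer_instance

lemma disc_eq (n : ℕ) (v : En n) :
    disc n v = (Subtype.val : Wv n v → En n) '' ball 0 1 := by
  ext z
  simp only [disc, Set.mem_ofPred_eq, Set.mem_image, mem_ball_zero_iff]
  constructor
  · rintro ⟨h1, h2⟩
    exact ⟨⟨z, Submodule.mem_orthogonal_singleton_iff_inner_right.2 h1⟩, h2, rfl⟩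
  · rintro ⟨w, hw, rfl⟩
    exact ⟨Submodule.mem_orthogonal_singleton_iff_inner_right.1 w.2, hw⟩

lemma measurableSet_disc_s9 (n : ℕ) (v : En n) : MeasurableSet (disc n v) := by
  apply MeasurableSet.inter
  · exact (measurableSet_singleton (0 : ℝ)).preimage (by fun_prop : Measurable fun z : En n => ⟪v, z⟫)
  · exact (isOpen_lt (by fun_prop : Continuous fun z : En n => ‖z‖) continuous_const).measurableSet

lemma isometry_val (n : ℕ) (v : En n) : Isometry (Subtype.val : Wv n v → En n) :=
  isometry_subtype_coe

lemma meas_disc (n : ℕ) (hn : 2 ≤ n) (v : En n) :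
    μH[(n : ℝ) - 1] (disc n v) = (μH[(n : ℝ) - 1] : Measure (Wv n v)) (ball 0 1) := by
  have : (2 : ℝ) ≤ n := by exact_mod_cast hn
  rw [disc_eq, (isometry_val n v).hausdorffMeasure_image (Or.inl (by linarith))]

lemma meas_disc_ne (n : ℕ) (hn : 2 ≤ n) (v : En n) (hv : ‖v‖ = 1) :
    μH[(n : ℝ) - 1] (disc n v) ≠ 0 ∧ μH[(n : ℝ) - 1] (disc n v) ≠ ∞ := by
  have := haar_Wv n hn v hv
  rw [meas_disc n hn]
  exact ⟨(measure_ball_pos _ _ one_pos).ne', measure_ball_lt_top.ne⟩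

lemma restrict_disc (n : ℕ) (hn : 2 ≤ n) (v : En n) :
    (μH[(n : ℝ) - 1] : Measure (En n)).restrict (disc n v) =
      ((μH[(n : ℝ) - 1] : Measure (Wv n v)).restrict (ball 0 1)).map Subtype.val := by
  have h2 : (2 : ℝ) ≤ n := by exact_mod_cast hn
  have hm : MeasurableEmbedding (Subtype.val : Wv n v → En n) :=
    MeasurableEmbedding.subtype_coe
      (Submodule.closed_of_finiteDimensional (Wv n v)).measurableSet
  have hpre : (ball 0 1 : Set (Wv n v)) = (Subtype.val : Wv n v → En n) ⁻¹' (disc n v) := by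
    rw [disc_eq, Set.preimage_image_eq _ Subtype.val_injective]
  rw [hpre, ← hm.restrict_map,
    (isometry_val n v).map_hausdorffMeasure (Or.inl (by linarith)),
    Measure.restrict_restrict (measurableSet_disc_s9 n v)]
  congr 1
  rw [disc_eq, Set.inter_eq_left.2 (Set.image_subset_range _ _)]

lemma lambda_prob (n : ℕ) (hn : 2 ≤ n) (v : En n) (hv : ‖v‖ = 1) :
    IsProbabilityMeasure (lambdaN n v) := by
  obtain ⟨h0, h1⟩ := meas_disc_ne n hn v hv
  constructor
  simp [lambdaN, ENNReal.inv_mul_cancel h0 h1]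

lemma proj_val (n : ℕ) (v : En n) (hv : ‖v‖ = 1) (x : En n) :
    ((Wv n v).orthogonalProjectionOnto x : En n) = x - ⟪v, x⟫ • v := by
  have := Submodule.starProjection_orthogonal_val (K := ℝ ∙ v) x
  rw [Submodule.starProjection_unit_singleton ℝ hv] at this
  exact this

lemma proj_self (n : ℕ) (v : En n) (hv : ‖v‖ = 1) :
    (Wv n v).orthogonalProjectionOnto v = 0 := by
  apply Subtype.ext
  rw [proj_val n v hv, real_inner_self_eq_norm_sq, hv]
  simp

/-! Finiteness and positivity of the sphere measure. -/

lemma sphere_pos (n : ℕ) (hn : 2 ≤ n) (v : En n) (hv : ‖v‖ = 1) :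
    μH[(n : ℝ) - 1] (unitSphere n) ≠ 0 := by
  have h2 : (2 : ℝ) ≤ n := by exact_mod_cast hn
  have := haar_Wv n hn v hv
  have hL : LipschitzWith 1 (fun x : En n => (Wv n v).orthogonalProjectionOnto x) := by
    refine LipschitzWith.of_dist_le_mul fun x y => ?_
    rw [dist_eq_norm, dist_eq_norm, ← map_sub]
    simpa using Submodule.norm_orthogonalProjectionOnto_apply_le (Wv n v) (x - y)
  have hsub : (ball 0 1 : Set (Wv n v)) ⊆
      (fun x : En n => (Wv n v).orthogonalProjectionOnto x) '' (unitSphere n) := by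
    intro w hw
    rw [mem_ball_zero_iff] at hw
    have hwv : ⟪(w : En n), v⟫ = 0 :=
      Submodule.mem_orthogonal_singleton_iff_inner_left.1 w.2
    refine ⟨(w : En n) + √(1 - ‖w‖ ^ 2) • v, ?_, ?_⟩
    · simp only [unitSphere, mem_sphere_zero_iff_norm]
      rw [← sq_eq_sq₀ (norm_nonneg _) zero_le_one, norm_add_sq_real, inner_smul_right, hwv,
        norm_smul, hv, mul_one, norm_of_nonneg (Real.sqrt_nonneg _), Real.sq_sqrt]
      · simp
      · nlinarith [norm_nonneg w]
    · have : (Wv n v).orthogonalProjectionOnto v = 0 := proj_self n v hv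
      simp [this]
  intro h
  have h3 := hL.hausdorffMeasure_image_le (d := (n : ℝ) - 1) (by linarith) (unitSphere n)
  rw [h, mul_zero] at h3
  exact (measure_ball_pos (μH[(n : ℝ) - 1] : Measure (Wv n v)) 0 one_pos).ne'
    (le_antisymm ((measure_mono hsub).trans h3) bot_le)

lemma sphere_fin (n : ℕ) (hn : 2 ≤ n) :
    μH[(n : ℝ) - 1] (unitSphere n) ≠ ∞ := by
  have h2 : (2 : ℝ) ≤ n := by exact_mod_cast hn
  refine (IsCompact.measure_lt_top_of_nhdsWithin (isCompact_sphere _ _) ?_).ne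
  intro v hv
  rw [mem_sphere_zero_iff_norm] at hv
  have := haar_Wv n hn v hv
  have hv0 : v ≠ 0 := by rintro rfl; simp at hv
  let N : Wv n v → En n := fun w => ‖(w : En n) + v‖⁻¹ • ((w : En n) + v)
  have hN : ContDiffAt ℝ 1 N 0 := by
    have h1 : ContDiffAt ℝ 1 (fun w : Wv n v => (w : En n) + v) 0 :=
      ((Wv n v).subtypeL.contDiff.contDiffAt).add contDiffAt_const
    have h2 : ((0 : Wv n v) : En n) + v ≠ 0 := by simpa using hv0
    exact ((h1.norm ℝ h2).inv (by simpa using hv0)).smul h1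
  obtain ⟨K, t, ht, hK⟩ := hN.exists_lipschitzOnWith
  let G : En n → Wv n v := fun x => (⟪v, x⟫)⁻¹ • (Wv n v).orthogonalProjectionOnto x
  have hPv : (Wv n v).orthogonalProjectionOnto v = 0 := proj_self n v hv
  have hvv : ⟪v, v⟫ = 1 := by rw [real_inner_self_eq_norm_sq, hv]; norm_num
  have hG : ContinuousAt G v := by
    have c1 : ContinuousAt (fun x : En n => ⟪v, x⟫) v := by fun_prop
    have c2 : ContinuousAt (fun x : En n => (Wv n v).orthogonalProjectionOnto x) v := by fun_prop
    exact (c1.inv₀ (by rw [hvv]; norm_num)).smul c2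
  have hG0 : G v = 0 := by simp [G, hPv]
  have htb : t ∩ ball 0 1 ∈ 𝓝 (0 : Wv n v) := inter_mem ht (ball_mem_nhds _ one_pos)
  have hpre : G ⁻¹' (t ∩ ball 0 1) ∈ 𝓝 v := hG (by rw [hG0]; exact htb)
  have hpos : {x : En n | 0 < ⟪v, x⟫} ∈ 𝓝 v :=
    (isOpen_lt (by fun_prop) (by fun_prop)).mem_nhds (by simp [hv0])
  refine ⟨N '' (t ∩ ball 0 1), ?_, ?_⟩
  · filter_upwards [mem_nhdsWithin_of_mem_nhds hpre, mem_nhdsWithin_of_mem_nhds hpos,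
      self_mem_nhdsWithin] with x hx1 hx2 hx3
    refine ⟨G x, hx1, ?_⟩
    rw [mem_sphere_zero_iff_norm] at hx3
    have hx2 : 0 < ⟪v, x⟫ := hx2
    have hdec : ((Wv n v).orthogonalProjectionOnto x : En n) = x - ⟪v, x⟫ • v := proj_val n v hv x
    have e : ((G x : Wv n v) : En n) + v = (⟪v, x⟫)⁻¹ • x := by
      simp only [G, Submodule.coe_smul, hdec, smul_sub, smul_smul, inv_mul_cancel₀ hx2.ne']
      simp
    simp only [N, e, norm_smul, hx3, norm_inv, mul_one, norm_of_nonneg hx2.le, inv_inv, smul_smul,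
      mul_inv_cancel₀ hx2.ne', one_smul]
  · refine ((hK.mono Set.inter_subset_left).hausdorffMeasure_image_le
      (d := (n : ℝ) - 1) (by linarith)).trans_lt ?_
    refine ENNReal.mul_lt_top (ENNReal.rpow_lt_top_of_nonneg (by linarith) (by simp)) ?_
    exact (measure_mono Set.inter_subset_right).trans_lt measure_ball_lt_top

lemma sigma_prob (n : ℕ) (hn : 2 ≤ n) (v : En n) (hv : ‖v‖ = 1) :
    IsProbabilityMeasure (sigmaN n) := by
  constructor
  simp [sigmaN, ENNReal.inv_mul_cancel (sphere_pos n hn v hv) (sphere_fin n hn)]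

/-! Rotating the discs. -/

/-- The reflection exchanging `u` and `v`, as an explicit formula. -/
def Rf (n : ℕ) (u v z : En n) : En n := z - (2 * (⟪u - v, z⟫ / ‖u - v‖ ^ 2)) • (u - v)

lemma Rf_eq (n : ℕ) (u v z : En n) : Rf n u v z = (ℝ ∙ (u - v))ᗮ.reflection z := by
  rw [Submodule.reflection_orthogonal_apply, Submodule.reflection_singleton_apply]
  simp [Rf, two_smul, two_mul, add_smul]

lemma lambda_map (n : ℕ) (u v : En n) (huv : ‖u‖ = ‖v‖) :
    lambdaN n v = (lambdaN n u).map (Rf n u v) := by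
  let e := (ℝ ∙ (u - v))ᗮ.reflection
  have hR : Rf n u v = e := by funext z; exact Rf_eq n u v z
  have heu : e u = v := Submodule.reflection_sub huv
  have hpre : disc n u = e ⁻¹' (disc n v) := by
    ext z
    simp only [disc, Set.mem_ofPred_eq, Set.mem_preimage, LinearIsometryEquiv.norm_map]
    rw [← heu, LinearIsometryEquiv.inner_map_map]
  have hmp := e.toIsometryEquiv.measurePreserving_hausdorffMeasure ((n : ℝ) - 1)
  have hmp' : MeasurePreserving e (μH[(n : ℝ) - 1] : Measure (En n)) μH[(n : ℝ) - 1] := hmp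
  have hmeas := hmp'.measure_preimage (measurableSet_disc_s9 n v).nullMeasurableSet
  rw [lambdaN, lambdaN, Measure.map_smul, hR, hpre, hmeas,
    (hmp'.restrict_preimage (measurableSet_disc_s9 n v)).map_eq]

lemma kinematic_eq (n : ℕ) (hn : 2 ≤ n) (u : En n) (hu : ‖u‖ = 1) :
    kinematic n = ((sigmaN n).prod (lambdaN n u)).map (fun p => (p.1, Rf n u p.1 p.2)) := by
  have := lambda_prob n hn u hu
  have hΦ : Measurable (fun p : En n × En n => (p.1, Rf n u p.1 p.2)) := by
    unfold Rf; fun_prop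
  have hmk : Measurable fun x : En n => (lambdaN n u).map (Prod.mk x) :=
    Measurable.map_prodMk_left
  have hd : Measurable fun p : En n × En n => Measure.dirac (p.1, Rf n u p.1 p.2) :=
    Measure.measurable_dirac.comp hΦ
  rw [Measure.prod, ← Measure.bind_dirac_eq_map _ hΦ, Measure.bind_bind hmk.aemeasurable
    hd.aemeasurable]
  refine Measure.bind_congr_right ?_
  have hs : ∀ᵐ v ∂(sigmaN n), v ∈ unitSphere n := by
    refine Measure.ae_smul_measure ?_ _
    exact ae_restrict_mem isClosed_sphere.measurableSet
  filter_upwards [hs] with v hv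
  have hv1 : ‖v‖ = 1 := by simpa [unitSphere] using hv
  have := lambda_prob n hn v hv1
  rw [Measure.dirac_prod, Measure.bind_dirac_eq_map _ hΦ,
    Measure.map_map hΦ measurable_prodMk_left, lambda_map n u v (hu.trans hv1.symm),
    Measure.map_map measurable_prodMk_left (by unfold Rf; fun_prop)]
  rfl

lemma norm_Rf (n : ℕ) (u v z : En n) : ‖Rf n u v z‖ = ‖z‖ := by
  rw [Rf_eq, LinearIsometryEquiv.norm_map]

lemma integral_kinematic (n : ℕ) (hn : 2 ≤ n) (u : En n) (hu : ‖u‖ = 1) :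
    ∫ p, ‖Xpt n p - Ypt n p‖ ∂(kinematic n) = ∫ z, 2 * √(1 - ‖z‖ ^ 2) ∂(lambdaN n u) := by
  have := lambda_prob n hn u hu
  have := sigma_prob n hn u hu
  have hΦ : Measurable (fun p : En n × En n => (p.1, Rf n u p.1 p.2)) := by
    unfold Rf; fun_prop
  rw [kinematic_eq n hn u hu, integral_map hΦ.aemeasurable
    (by unfold Xpt Ypt; exact Continuous.aestronglyMeasurable (by fun_prop))]
  have h1 : ∫ z, 2 * √(1 - ‖z‖ ^ 2) ∂(lambdaN n u) =
      ∫ p, 2 * √(1 - ‖p.2‖ ^ 2) ∂((sigmaN n).prod (lambdaN n u)) := by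
    rw [integral_fun_snd (fun z : En n => 2 * √(1 - ‖z‖ ^ 2))]
    simp
  rw [h1]
  apply integral_congr_ae
  have hs : ∀ᵐ v ∂(sigmaN n), v ∈ unitSphere n := by
    refine Measure.ae_smul_measure ?_ _
    exact ae_restrict_mem isClosed_sphere.measurableSet
  have hs' : ∀ᵐ p ∂((sigmaN n).prod (lambdaN n u)), p.1 ∈ unitSphere n :=
    Measure.quasiMeasurePreserving_fst.ae hs
  filter_upwards [hs'] with p hp
  have hp1 : ‖p.1‖ = 1 := by simpa [unitSphere] using hp
  have e : Xpt n (p.1, Rf n u p.1 p.2) - Ypt n (p.1, Rf n u p.1 p.2) =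
      -((2 * √(1 - ‖p.2‖ ^ 2)) • p.1) := by
    simp only [Xpt, Ypt, norm_Rf, two_mul, add_smul]; abel
  rw [e, norm_neg, norm_smul, hp1, mul_one, norm_of_nonneg (by positivity)]

lemma integral_lambda (n : ℕ) (hn : 2 ≤ n) (u : En n) (hu : ‖u‖ = 1) :
    ∫ z, 2 * √(1 - ‖z‖ ^ 2) ∂(lambdaN n u) =
      2 * (((n - 1 : ℕ) : ℝ) * ∫ y in (0 : ℝ)..1, y ^ (n - 2) * √(1 - y ^ 2)) := by
  have := haar_Wv n hn u hu
  have hfr := finrank_Wv n hn u hu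
  have : Nontrivial (Wv n u) := Module.nontrivial_of_finrank_pos (R := ℝ) (by omega)
  obtain ⟨h0, h1⟩ := meas_disc_ne n hn u hu
  rw [lambdaN, integral_smul_measure, restrict_disc n hn, integral_map (by fun_prop)
    (Continuous.aestronglyMeasurable (by fun_prop)), integral_const_mul,
    ← integral_indicator measurableSet_ball]
  have e1 : ∀ w : Wv n u, (ball (0 : Wv n u) 1).indicator
      (fun w : Wv n u => √(1 - ‖(w : En n)‖ ^ 2)) w =
      (Set.Iio (1 : ℝ)).indicator (fun y => √(1 - y ^ 2)) ‖w‖ := by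
    intro w
    simp [Set.indicator]
  simp_rw [e1]
  rw [integral_fun_norm_addHaar (μH[(n : ℝ) - 1] : Measure (Wv n u)), hfr]
  have e2 : ∫ y in Set.Ioi (0 : ℝ), y ^ (n - 1 - 1) •
      (Set.Iio (1 : ℝ)).indicator (fun y => √(1 - y ^ 2)) y =
      ∫ y in (0 : ℝ)..1, y ^ (n - 2) * √(1 - y ^ 2) := by
    rw [intervalIntegral.integral_of_le zero_le_one, integral_Ioc_eq_integral_Ioo,
      ← Set.Ioi_inter_Iio, Set.inter_comm, ← Measure.restrict_restrict measurableSet_Iio,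
      ← integral_indicator measurableSet_Iio]
    congr 1
    funext y
    simp [Set.indicator, Nat.sub_sub]
  rw [e2, meas_disc n hn, Measure.real]
  rw [meas_disc n hn] at h0 h1
  have h3 : ((μH[(n : ℝ) - 1] : Measure (Wv n u)) (ball 0 1)).toReal ≠ 0 :=
    ENNReal.toReal_ne_zero.2 ⟨h0, h1⟩
  rw [ENNReal.toReal_inv]
  simp only [nsmul_eq_mul, smul_eq_mul]
  field_simp

lemma upper_bd (k : ℕ) :
    ((k + 1 : ℕ) : ℝ) * ∫ y in (0 : ℝ)..1, y ^ k * √(1 - y ^ 2) ≤ 3 / 2 / √((k + 1 : ℕ) : ℝ) := by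
  set m : ℝ := ((k + 1 : ℕ) : ℝ) with hm
  have hm1 : m = k + 1 := by simp [hm]
  have hm0 : 0 < m := by rw [hm1]; positivity
  set s := √m with hs
  have hs0 : 0 < s := Real.sqrt_pos.2 hm0
  have hss : s ^ 2 = m := Real.sq_sqrt hm0.le
  have hle : ∫ y in (0 : ℝ)..1, y ^ k * √(1 - y ^ 2) ≤
      ∫ y in (0 : ℝ)..1, ((1 / (2 * s) + s / 2) * y ^ k - s / 2 * y ^ (k + 2)) := by
    refine intervalIntegral.integral_mono_on zero_le_one
      (Continuous.intervalIntegrable (by fun_prop) _ _)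
      (Continuous.intervalIntegrable (by fun_prop) _ _) ?_
    intro y hy
    have hy2 : 0 ≤ 1 - y ^ 2 := by nlinarith [hy.1, hy.2]
    set q := √(1 - y ^ 2) with hq
    have hqq : q ^ 2 = 1 - y ^ 2 := Real.sq_sqrt hy2
    have h1 : q ≤ 1 / (2 * s) + s / 2 * (1 - y ^ 2) := by
      rw [← hqq]
      have : 1 / (2 * s) + s / 2 * q ^ 2 - q = (s * q - 1) ^ 2 / (2 * s) := by field_simp; ring
      have h2 : 0 ≤ (s * q - 1) ^ 2 / (2 * s) := by positivity
      linarith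
    calc y ^ k * q ≤ y ^ k * (1 / (2 * s) + s / 2 * (1 - y ^ 2)) :=
          mul_le_mul_of_nonneg_left h1 (pow_nonneg hy.1 k)
      _ = _ := by ring
  have hval : ∫ y in (0 : ℝ)..1, ((1 / (2 * s) + s / 2) * y ^ k - s / 2 * y ^ (k + 2)) =
      (1 / (2 * s) + s / 2) * (1 / m) - s / 2 * (1 / (m + 2)) := by
    rw [intervalIntegral.integral_sub (Continuous.intervalIntegrable (by fun_prop) _ _)
      (Continuous.intervalIntegrable (by fun_prop) _ _), intervalIntegral.integral_const_mul,
      intervalIntegral.integral_const_mul, integral_pow, integral_pow, hm1]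
    simp
    left
    ring
  have h4 : m * ∫ y in (0 : ℝ)..1, y ^ k * √(1 - y ^ 2) ≤
      m * ((1 / (2 * s) + s / 2) * (1 / m) - s / 2 * (1 / (m + 2))) :=
    mul_le_mul_of_nonneg_left (hle.trans hval.le) hm0.le
  refine h4.trans ?_
  rw [← hss]
  have : 3 / 2 / s - s ^ 2 * ((1 / (2 * s) + s / 2) * (1 / s ^ 2) - s / 2 * (1 / (s ^ 2 + 2))) =
      2 / (s * (s ^ 2 + 2)) := by field_simp; ring
  have h5 : 0 ≤ 2 / (s * (s ^ 2 + 2)) := by positivity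
  linarith

lemma lower_bd (k : ℕ) :
    1 / 4 / √((k + 1 : ℕ) : ℝ) ≤ ((k + 1 : ℕ) : ℝ) * ∫ y in (0 : ℝ)..1, y ^ k * √(1 - y ^ 2) := by
  set m : ℝ := ((k + 1 : ℕ) : ℝ) with hm
  have hm1 : m = k + 1 := by simp [hm]
  have hm0 : 1 ≤ m := by rw [hm1]; simp
  set s := √m with hs
  have hs0 : 0 < s := Real.sqrt_pos.2 (by linarith)
  have hss : s ^ 2 = m := Real.sq_sqrt (by linarith)
  set r : ℝ := 1 - 1 / (2 * m) with hr
  have hinv : 1 / (2 * m) ≤ 1 / 2 := by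
    apply one_div_le_one_div_of_le <;> linarith
  have hinv0 : 0 < 1 / (2 * m) := by positivity
  have hr0 : 0 ≤ r := by linarith
  have hr1 : r ≤ 1 := by linarith
  have hb : 1 / 2 ≤ r ^ (k + 1) := by
    have := one_add_mul_le_pow (a := -(1 / (2 * m))) (by linarith) (k + 1)
    rw [← hm] at this
    have e : m * -(1 / (2 * m)) = - (1 / 2) := by field_simp
    rw [e] at this
    have e2 : r = 1 + -(1 / (2 * m)) := by rw [hr]; ring
    rw [e2]; linarith
  have hle : ∫ y in (0 : ℝ)..r, y ^ k * (1 / (2 * s)) ≤ ∫ y in (0 : ℝ)..r, y ^ k * √(1 - y ^ 2) := by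
    refine intervalIntegral.integral_mono_on hr0
      (Continuous.intervalIntegrable (by fun_prop) _ _)
      (Continuous.intervalIntegrable (by fun_prop) _ _) ?_
    intro y hy
    refine mul_le_mul_of_nonneg_left ?_ (pow_nonneg hy.1 k)
    apply Real.le_sqrt_of_sq_le
    have e : (1 / (2 * s)) ^ 2 = 1 / (2 * m) / 2 := by rw [← hss]; field_simp; try norm_num
    rw [e]
    have : y ^ 2 ≤ r := by nlinarith [hy.1, hy.2]
    linarith
  have hle2 : ∫ y in (0 : ℝ)..r, y ^ k * √(1 - y ^ 2) ≤ ∫ y in (0 : ℝ)..1, y ^ k * √(1 - y ^ 2) := by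
    rw [← intervalIntegral.integral_add_adjacent_intervals (b := r) (c := 1)
      (Continuous.intervalIntegrable (by fun_prop) _ _)
      (Continuous.intervalIntegrable (by fun_prop) _ _)]
    have : 0 ≤ ∫ y in r..1, y ^ k * √(1 - y ^ 2) := by
      refine intervalIntegral.integral_nonneg hr1 fun y hy => ?_
      have := hr0.trans hy.1
      positivity
    linarith
  have hval : ∫ y in (0 : ℝ)..r, y ^ k * (1 / (2 * s)) = r ^ (k + 1) / m * (1 / (2 * s)) := by
    rw [intervalIntegral.integral_mul_const, integral_pow, hm1]
    simp
  calc 1 / 4 / s = (1 / 2) * (1 / (2 * s)) := by ring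
    _ ≤ r ^ (k + 1) * (1 / (2 * s)) := by gcongr
    _ = m * (r ^ (k + 1) / m * (1 / (2 * s))) := by field_simp
    _ ≤ _ := mul_le_mul_of_nonneg_left (hval ▸ hle.trans hle2) (by linarith)

/-- The expected distance between the entry and exit points of a random line meeting
`S^{n-1}` is of order `n^{-1/2}`. -/
theorem expected_dist_entry_exit :
    ∃ c C : ℝ, 0 < c ∧ 0 < C ∧ ∀ n : ℕ, 2 ≤ n →
      c * (n : ℝ) ^ (-(1 / 2 : ℝ)) ≤ (∫ p, ‖Xpt n p - Ypt n p‖ ∂(kinematic n)) ∧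
      (∫ p, ‖Xpt n p - Ypt n p‖ ∂(kinematic n)) ≤ C * (n : ℝ) ^ (-(1 / 2 : ℝ)) := by
  refine ⟨1 / 2, 6, by norm_num, by norm_num, fun n hn => ?_⟩
  obtain ⟨k, rfl⟩ : ∃ k, n = k + 2 := ⟨n - 2, by omega⟩
  let u : En (k + 2) := EuclideanSpace.single 0 1
  have hu : ‖u‖ = 1 := by simp [u]
  rw [integral_kinematic _ hn u hu, integral_lambda _ hn u hu]
  have hU := upper_bd k
  have hL := lower_bd k
  have e1 : k + 2 - 1 = k + 1 := by omega
  have e2 : k + 2 - 2 = k := by omega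
  rw [e1, e2]
  have hp : ((k + 2 : ℕ) : ℝ) ^ (-(1 / 2 : ℝ)) = 1 / √((k + 2 : ℕ) : ℝ) := by
    rw [Real.rpow_neg (by positivity), Real.sqrt_eq_rpow, ← one_div]
  rw [hp]
  have ha : 0 < √((k + 1 : ℕ) : ℝ) := Real.sqrt_pos.2 (by positivity)
  have hb : 0 < √((k + 2 : ℕ) : ℝ) := Real.sqrt_pos.2 (by positivity)
  have hab : √((k + 1 : ℕ) : ℝ) ≤ √((k + 2 : ℕ) : ℝ) := Real.sqrt_le_sqrt (by push_cast; linarith)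
  have hba : √((k + 2 : ℕ) : ℝ) ≤ 2 * √((k + 1 : ℕ) : ℝ) := by
    rw [Real.sqrt_le_left (by positivity), mul_pow, Real.sq_sqrt (by positivity)]
    push_cast; linarith [(Nat.cast_nonneg k : (0 : ℝ) ≤ k)]
  have h1 : 1 / √((k + 2 : ℕ) : ℝ) ≤ 1 / √((k + 1 : ℕ) : ℝ) := one_div_le_one_div_of_le ha hab
  have h2 : 1 / √((k + 1 : ℕ) : ℝ) ≤ 2 * (1 / √((k + 2 : ℕ) : ℝ)) := by
    rw [mul_one_div, div_le_div_iff₀ ha hb]; linarith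
  have h3 : 1 / 4 / √((k + 1 : ℕ) : ℝ) = 1 / 4 * (1 / √((k + 1 : ℕ) : ℝ)) := by ring
  have h4 : 3 / 2 / √((k + 1 : ℕ) : ℝ) = 3 / 2 * (1 / √((k + 1 : ℕ) : ℝ)) := by ring
  rw [h3] at hL
  rw [h4] at hU
  constructor <;> linarith

end
end
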